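/- arXiv:1501.03868 — 3 statements merged into one kernel-verified Lean document; each statement's English description precedes it below -/
import Mathlib

section
/- Let P be an optimistic DAG MPCS protocol over a set S of signers with k = |S|. Let v ∈ Sig(P) be a causally earliest vertex of its signer from which a signature is sent, i.e., for every w ∈ Sig(P), w ≺ v implies r(w) ≠ r(v). If every permutation of S ∖ {r(v)} occurs as a (not necessarily consecutive) subsequence of some sequence in seq(I, v), then for every vertex w with v ≺ w and r(w) = r(v), every permutation of S ∖ {r(w)} occurs as a subsequence of some sequence in seq(I, w). -/
attribute [local instance] Classical.propDecidable

/-- Causal precedence: a nonempty directed path. -/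
def cprec {V : Type} (E : V → V → Prop) : V → V → Prop := Relation.TransGen E

/-- Reflexive causal precedence. -/
def cpreceq {V : Type} (E : V → V → Prop) (v w : V) : Prop := cprec E v w ∨ v = w

/-- A DAG MPCS protocol over vertex type `V` and signer type `S`. -/
structure MPCS (V S : Type) where
  E : V → V → Prop
  vT : V
  role : V → Option S
  Sigma0 : Set V
  vfin : Finite V
  sfin : Finite S
  two_le_card : 2 ≤ Nat.card S
  acyclic : ∀ v, ¬ cprec E v v
  vT_role : role vT = none
  role_eq_none : ∀ v, role v = none → v = vT
  exit_edges : ∀ v, v ≠ vT → E v vT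
  msg_structure : ∀ v w, cprec E v w →
    E v w ∨ ∃ u, cprec E v u ∧ cprec E u w ∧ (role u = role v ∨ role u = role w)

namespace MPCS

variable {V S : Type} (P : MPCS V S)

def epsEdge (e : V × V) : Prop := P.E e.1 e.2 ∧ P.role e.1 = P.role e.2

def exitEdge (e : V × V) : Prop := P.E e.1 e.2 ∧ e.2 = P.vT

def msgEdge (e : V × V) : Prop := P.E e.1 e.2 ∧ P.role e.1 ≠ P.role e.2 ∧ e.2 ≠ P.vT

/-- The knowledge of a vertex. -/
def K (v : V) : Set (V × V) :=
  {e | P.msgEdge e ∧ cpreceq P.E e.2 v ∧ P.role e.2 = P.role v}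

/-- The pre-knowledge of a vertex. -/
def Kpre (v : V) : Set (V × V) :=
  {e | P.msgEdge e ∧ cprec P.E e.2 v ∧ P.role e.2 = P.role v}

def KpreSet (U : Set V) : Set (V × V) := ⋃ v ∈ U, P.Kpre v

/-- The signing set Sig(P). -/
def Sig : Set V := {v ∈ P.Sigma0 | ∃ w, P.msgEdge (v, w)}

/-- The initial set Init(P). -/
def InitSet : Set V :=
  {v | {a : S | (∃ e ∈ P.Kpre v, P.role e.1 = some a) ∨ P.role v = some a} ≠ Set.univ}

/-- The end set End(P). -/
def EndSet : Set V :=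
  {v | {a : S | (∃ e ∈ P.K v, e.1 ∈ P.Sig ∧ P.role e.1 = some a) ∨ P.role v = some a} = Set.univ}

def Optimistic : Prop :=
  ∀ a : S, (∃ v ∈ P.Sig, P.role v = some a) ∧ (∃ v ∈ P.EndSet, P.role v = some a)

def hon (v : V) (U : Set V) : Prop :=
  ¬ ∃ e ∈ P.KpreSet U, cpreceq P.E v e.1 ∧ P.role e.1 = P.role v

/-- `(v₁, …, v_l | s)` is an abort-chaining sequence. -/
def IsAC (vs : List V) (s : V) : Prop :=
  vs ≠ [] ∧ vs.length ≤ Nat.card S ∧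
  (∀ h : vs ≠ [], vs.head h ∈ P.InitSet) ∧
  vs.Pairwise (fun v w => P.role v ≠ P.role w) ∧
  (∀ i (hi : i < vs.length), P.hon (vs.get ⟨i, hi⟩) {w | w ∈ vs.take (i + 1)}) ∧
  (∀ i (hi : i + 1 < vs.length),
    P.hon (vs.get ⟨i, Nat.lt_of_succ_lt hi⟩) {w | w ∈ vs.take (i + 2)}) ∧
  (∀ h : vs ≠ [],
    (∀ v, cprec P.E v (vs.getLast h) → P.role v = P.role (vs.getLast h) → v ∉ P.EndSet) ∧
    s ∈ P.Sig ∧ s ∉ P.EndSet ∧ P.role s = P.role (vs.getLast h) ∧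
    ¬ cpreceq P.E (vs.getLast h) s)

def NoAC : Prop := ¬ ∃ vs s, P.IsAC vs s

/-- The set I of causally last vertices of each signer in the initial set. -/
def Iset : Set V :=
  {v ∈ P.InitSet | ∀ w, cprec P.E v w → P.role v = P.role w → w ∉ P.InitSet}

def PathFrom (I : Set V) (v : V) (p : List V) : Prop :=
  ∃ h : p ≠ [], p.Chain' P.E ∧ p.head h ∈ I ∧ p.getLast h = v

/-- Every permutation of `S ∖ {r(v)}` appears as a subsequence of a sequence in seq(I, v). -/
def PermCond (v : V) : Prop :=
  ∀ as : List S, as.Nodup → (∀ b : S, b ∈ as ↔ some b ≠ P.role v) →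
    ∃ p, P.PathFrom P.Iset v p ∧ (as.map some).Sublist (p.map P.role)

end MPCS

namespace MPCS

variable {V S : Type} {P : MPCS V S} {I : Set V}

/-- A path can be extended along an edge leaving its endpoint. -/
theorem PathFrom.concat {v w : V} {p : List V} (hp : P.PathFrom I v p) (hvw : P.E v w) :
    P.PathFrom I w (p ++ [w]) := by
  obtain ⟨hne, hchain, hhead, hlast⟩ := hp
  refine ⟨by simp, ?_, by rwa [List.head_append_of_ne_nil hne], by simp⟩
  refine List.IsChain.append hchain (List.isChain_singleton w) ?_
  intro x hx y hy
  rw [List.getLast?_eq_some_getLast hne, hlast, Option.mem_some_iff] at hx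
  rw [List.head?_singleton, Option.mem_some_iff] at hy
  rwa [← hx, ← hy]

/-- A path can be extended to any causal successor of its endpoint. -/
theorem PathFrom.exists_prefix_of_cprec {v w : V} {p : List V} (hp : P.PathFrom I v p)
    (hvw : cprec P.E v w) : ∃ q, P.PathFrom I w q ∧ p <+: q := by
  induction hvw with
  | single h => exact ⟨_, hp.concat h, List.prefix_append _ _⟩
  | tail _ h ih =>
    obtain ⟨q, hq, hpq⟩ := ih
    exact ⟨_, hq.concat h, hpq.trans (List.prefix_append _ _)⟩

end MPCS

/-- **Fact 1.** Let `v ∈ Sig(P)` be a causally earliest vertex of its signer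
from which a signature is sent. If every permutation of `S ∖ {r(v)}` occurs as a
subsequence of some sequence in `seq(I, v)`, then the same holds at every later vertex
`w` of the same signer. -/
theorem perm_condition_propagates {V S : Type} (P : MPCS V S)
    (hopt : P.Optimistic) (v : V) (hv : v ∈ P.Sig)
    (hearliest : ∀ w ∈ P.Sig, cprec P.E w v → P.role w ≠ P.role v)
    (hperm : P.PermCond v) :
    ∀ w, cprec P.E v w → P.role w = P.role v → P.PermCond w := by
  intro w hvw hrole as hnodup has
  obtain ⟨p, hp, hsub⟩ := hperm as hnodup (by rwa [hrole] at has)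
  obtain ⟨q, hq, hpq⟩ := hp.exists_prefix_of_cprec hvw
  exact ⟨q, hq, hsub.trans (hpq.sublist.map P.role)⟩
end

section
/- There exists an optimistic DAG MPCS protocol P over a set S of three signers such that for every v ∈ Sig(P) and every permutation of S ∖ {r(v)}, some sequence in seq(I, v) contains that permutation as a (not necessarily consecutive) subsequence, and yet P has an abort-chaining sequence (hence P is not fair). In other words, the permutation condition that is necessary for fairness of DAG MPCS protocols is not sufficient. -/
attribute [local instance] Classical.propDecidable

namespace ForkedChain

/-- The chain `0, …, 10` of vertices, played in turn by signers `0, 1, 2`, in which each vertex is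
joined to the next three, together with a dead-end vertex `11` forking off after `2` and the
trusted party `12`. -/
def edge (i j : Fin 13) : Prop :=
  (i.val < 12 ∧ j.val = 12) ∨ (i < j ∧ j.val ≤ 10 ∧ j.val ≤ i.val + 3) ∨ (i.val ≤ 2 ∧ j.val = 11)

/-- The dead-end vertex `11` is played by signer `0`. -/
def role : Fin 13 → Option (Fin 3) :=
  ![some 0, some 1, some 2, some 0, some 1, some 2, some 0, some 1, some 2, some 0, some 1,
    some 0, none]

theorem cprec_edge_of_lt {i j : Fin 13} (hij : i < j) (hj : j.val ≤ 10) : cprec edge i j := by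
  obtain ⟨j, hj13⟩ := j
  induction j with
  | zero => exact absurd hij (by simp)
  | succ k ih =>
    by_cases h : i.val = k
    · exact .single (Or.inr (Or.inl ⟨hij, hj, by simp only; omega⟩))
    · have hik : i < (⟨k, by omega⟩ : Fin 13) := by
        simp only [Fin.lt_def] at hij ⊢; omega
      refine (ih (by omega) hik (by simp only at hj ⊢; omega)).tail (Or.inr (Or.inl ⟨?_, hj, ?_⟩))
      · simp [Fin.lt_def]
      · simp only; omega

theorem cprec_edge_iff {i j : Fin 13} :
    cprec edge i j ↔
      (i.val < 12 ∧ j.val = 12) ∨ (i < j ∧ j.val ≤ 10) ∨ (i.val ≤ 2 ∧ j.val = 11) := by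
  constructor
  · intro h
    induction h with
    | single h => unfold edge at h; omega
    | tail _ h ih => unfold edge at h; omega
  · rintro (h | h | h)
    · exact .single (Or.inl h)
    · exact cprec_edge_of_lt h.1 h.2
    · exact .single (Or.inr (Or.inr h))

theorem role_eq_none {v : Fin 13} (h : role v = none) : v = 12 := by
  fin_cases v <;> simp_all [role]

theorem role_add_three {v w : Fin 13} (h : w.val = v.val + 3) (hw : w.val ≤ 10) :
    role w = role v := by
  fin_cases v <;> fin_cases w <;> simp_all [role]

theorem role_eq_zero {v : Fin 13} (h : role v = some 0) :
    v = 0 ∨ v = 3 ∨ v = 6 ∨ v = 9 ∨ v = 11 := by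
  fin_cases v <;> simp_all [role]

theorem role_eq_one {v : Fin 13} (h : role v = some 1) : v = 1 ∨ v = 4 ∨ v = 7 ∨ v = 10 := by
  fin_cases v <;> simp_all [role]

theorem role_eq_two {v : Fin 13} (h : role v = some 2) : v = 2 ∨ v = 5 ∨ v = 8 := by
  fin_cases v <;> simp_all [role]

/-- The protocol on this graph in which `6`, `7` and `8` send signatures. -/
def protocol : MPCS (Fin 13) (Fin 3) where
  E := edge
  vT := 12
  role := role
  Sigma0 := {6, 7, 8}
  vfin := inferInstance
  sfin := inferInstance
  two_le_card := by simp
  acyclic v h := by rw [cprec_edge_iff] at h; omega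
  vT_role := rfl
  role_eq_none _ h := role_eq_none h
  exit_edges v h := Or.inl (by omega)
  msg_structure v w h := by
    rw [cprec_edge_iff] at h
    by_cases hvw : w.val ≤ 10 ∧ v.val + 3 < w.val
    · refine Or.inr ⟨⟨v.val + 3, by omega⟩, cprec_edge_of_lt ?_ ?_, cprec_edge_of_lt ?_ hvw.1,
        Or.inl (role_add_three rfl ?_)⟩ <;> simp only [Fin.lt_def] <;> omega
    · left; unfold edge; omega

theorem msgEdge_protocol {x y : Fin 13} (hxy : x < y) (hy : y.val ≤ 10) (h : y.val ≤ x.val + 3)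
    (hr : role x ≠ role y) : protocol.msgEdge (x, y) :=
  ⟨Or.inr (Or.inl ⟨hxy, hy, h⟩), hr, fun h12 : y = 12 => by omega⟩

theorem lt_of_mem_Kpre {v : Fin 13} {e : Fin 13 × Fin 13} (he : e ∈ protocol.Kpre v) :
    e.1 < e.2 ∧ e.2 < v ∧ role e.1 ≠ role e.2 ∧ role e.2 = role v ∧
      (v.val = 11 → e.2.val ≤ 2) := by
  obtain ⟨⟨hE, hne, -⟩, hp, hr⟩ := he
  have hE' : edge e.1 e.2 := hE
  have hp' := cprec_edge_iff.1 hp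
  unfold edge at hE'
  exact ⟨by omega, by omega, hne, hr, by omega⟩

theorem mem_Sig {v : Fin 13} : v ∈ protocol.Sig ↔ v = 6 ∨ v = 7 ∨ v = 8 := by
  constructor
  · exact fun h => h.1
  · intro h
    refine ⟨h, ?_⟩
    rcases h with rfl | rfl | rfl
    · exact ⟨7, msgEdge_protocol (by simp) (by simp) (by simp) (by simp [role])⟩
    · exact ⟨8, msgEdge_protocol (by simp) (by simp) (by simp) (by simp [role])⟩
    · exact ⟨9, msgEdge_protocol (by simp) (by simp) (by simp) (by simp [role])⟩

theorem mem_InitSet {v : Fin 13} (a : Fin 3) (hv : role v ≠ some a)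
    (h : ∀ e ∈ protocol.Kpre v, role e.1 ≠ some a) : v ∈ protocol.InitSet := by
  intro huniv
  rcases (Set.eq_univ_iff_forall.1 huniv a) with ⟨e, he, hr⟩ | hr
  · exact h e he hr
  · exact hv hr

theorem notMem_InitSet {x x' y w : Fin 13} (he : protocol.msgEdge (x, y))
    (he' : protocol.msgEdge (x', y)) (hyw : y < w) (hw : w.val ≤ 10) (hr : role y = role w)
    (hcover : ∀ a, role x = some a ∨ role x' = some a ∨ role w = some a) :
    w ∉ protocol.InitSet := by
  refine fun h => h (Set.eq_univ_iff_forall.2 fun a => ?_)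
  have hp : cprec edge y w := cprec_edge_of_lt hyw hw
  rcases hcover a with h | h | h
  · exact Or.inl ⟨_, ⟨he, hp, hr⟩, h⟩
  · exact Or.inl ⟨_, ⟨he', hp, hr⟩, h⟩
  · exact Or.inr h

theorem mem_EndSet {x x' y y' v : Fin 13} (hx : x ∈ protocol.Sig) (hx' : x' ∈ protocol.Sig)
    (he : protocol.msgEdge (x, y)) (he' : protocol.msgEdge (x', y'))
    (hy : cpreceq edge y v) (hy' : cpreceq edge y' v) (hr : role y = role v)
    (hr' : role y' = role v) (hcover : ∀ a, role x = some a ∨ role x' = some a ∨ role v = some a) :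
    v ∈ protocol.EndSet := by
  refine Set.eq_univ_iff_forall.2 fun a => ?_
  rcases hcover a with h | h | h
  · exact Or.inl ⟨_, ⟨he, hy, hr⟩, hx, h⟩
  · exact Or.inl ⟨_, ⟨he', hy', hr'⟩, hx', h⟩
  · exact Or.inr h

theorem notMem_EndSet {v : Fin 13} (hv : v.val ≤ 6) : v ∉ protocol.EndSet := by
  intro h
  obtain ⟨a, ha⟩ : ∃ a : Fin 3, role v ≠ some a := by
    by_cases h0 : role v = some 0
    · exact ⟨1, by simp [h0]⟩
    · exact ⟨0, h0⟩
  rcases (Set.eq_univ_iff_forall.1 h a) with ⟨e, ⟨⟨hE, -, -⟩, hp, -⟩, hs, -⟩ | hr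
  · have hE' : edge e.1 e.2 := hE
    have hp' : e.2.val ≤ v.val := by
      rcases hp with hp | hp
      · have := cprec_edge_iff.1 hp
        omega
      · exact le_of_eq (congrArg Fin.val hp)
    have hs' := mem_Sig.1 hs
    unfold edge at hE'
    omega
  · exact ha hr

theorem optimistic_protocol : protocol.Optimistic := by
  intro a
  have h6 : (6 : Fin 13) ∈ protocol.Sig := mem_Sig.2 (by simp)
  have h7 : (7 : Fin 13) ∈ protocol.Sig := mem_Sig.2 (by simp)
  have h8 : (8 : Fin 13) ∈ protocol.Sig := mem_Sig.2 (by simp)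
  fin_cases a
  · refine ⟨⟨6, h6, rfl⟩, 9, mem_EndSet h7 h8 (y := 9) (y' := 9) ?_ ?_ (Or.inr rfl) (Or.inr rfl)
      rfl rfl ?_, rfl⟩
    · exact msgEdge_protocol (by simp) (by simp) (by simp) (by simp [role])
    · exact msgEdge_protocol (by simp) (by simp) (by simp) (by simp [role])
    · intro a; fin_cases a <;> simp [role]
  · refine ⟨⟨7, h7, rfl⟩, 10, mem_EndSet h6 h8 (y := 7) (y' := 10) ?_ ?_ (Or.inl ?_) (Or.inr rfl)
      rfl rfl ?_, rfl⟩
    · exact msgEdge_protocol (by simp) (by simp) (by simp) (by simp [role])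
    · exact msgEdge_protocol (by simp) (by simp) (by simp) (by simp [role])
    · exact cprec_edge_of_lt (by simp) (by simp)
    · intro a; fin_cases a <;> simp [role]
  · refine ⟨⟨8, h8, rfl⟩, 8, mem_EndSet h6 h7 (y := 8) (y' := 8) ?_ ?_ (Or.inr rfl) (Or.inr rfl)
      rfl rfl ?_, rfl⟩
    · exact msgEdge_protocol (by simp) (by simp) (by simp) (by simp [role])
    · exact msgEdge_protocol (by simp) (by simp) (by simp) (by simp [role])
    · intro a; fin_cases a <;> simp [role]

theorem two_mem_Iset : (2 : Fin 13) ∈ protocol.Iset := by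
  refine ⟨mem_InitSet 0 (by simp [role]) fun e he => ?_, fun w hw hr => ?_⟩
  · have h := lt_of_mem_Kpre he
    have := role_eq_two (h.2.2.2.1.trans rfl)
    omega
  · have hw' := cprec_edge_iff.1 hw
    have := role_eq_two (hr.symm.trans rfl : role w = some 2)
    refine notMem_InitSet (x := 0) (x' := 1) (y := 2) ?_ ?_ (by omega) (by omega) hr ?_
    · exact msgEdge_protocol (by simp) (by simp) (by simp) (by simp [role])
    · exact msgEdge_protocol (by simp) (by simp) (by simp) (by simp [role])
    · have hr' : role w = some 2 := hr.symm.trans rfl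
      rw [hr']
      intro a; fin_cases a <;> simp [role]

theorem three_mem_Iset : (3 : Fin 13) ∈ protocol.Iset := by
  refine ⟨mem_InitSet 1 (by simp [role]) fun e he => ?_, fun w hw hr => ?_⟩
  · have h := lt_of_mem_Kpre he
    have := role_eq_zero (h.2.2.2.1.trans rfl)
    omega
  · have hw' := cprec_edge_iff.1 hw
    have := role_eq_zero (hr.symm.trans rfl : role w = some 0)
    refine notMem_InitSet (x := 1) (x' := 2) (y := 3) ?_ ?_ (by omega) (by omega) hr ?_
    · exact msgEdge_protocol (by simp) (by simp) (by simp) (by simp [role])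
    · exact msgEdge_protocol (by simp) (by simp) (by simp) (by simp [role])
    · have hr' : role w = some 0 := hr.symm.trans rfl
      rw [hr']
      intro a; fin_cases a <;> simp [role]

theorem four_mem_Iset : (4 : Fin 13) ∈ protocol.Iset := by
  refine ⟨mem_InitSet 2 (by simp [role]) fun e he h2 => ?_, fun w hw hr => ?_⟩
  · have h := lt_of_mem_Kpre he
    have := role_eq_one (h.2.2.2.1.trans rfl)
    have := role_eq_two h2
    omega
  · have hw' := cprec_edge_iff.1 hw
    have := role_eq_one (hr.symm.trans rfl : role w = some 1)
    refine notMem_InitSet (x := 2) (x' := 3) (y := 4) ?_ ?_ (by omega) (by omega) hr ?_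
    · exact msgEdge_protocol (by simp) (by simp) (by simp) (by simp [role])
    · exact msgEdge_protocol (by simp) (by simp) (by simp) (by simp [role])
    · have hr' : role w = some 1 := hr.symm.trans rfl
      rw [hr']
      intro a; fin_cases a <;> simp [role]

theorem permCond_of_pair {v : Fin 13} {b c : Fin 3} (hbc : b ≠ c)
    (hv : ∀ a : Fin 3, some a ≠ role v ↔ a = b ∨ a = c)
    (h : ∃ p, protocol.PathFrom protocol.Iset v p ∧ [some b, some c].Sublist (p.map role))
    (h' : ∃ p, protocol.PathFrom protocol.Iset v p ∧ [some c, some b].Sublist (p.map role)) :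
    protocol.PermCond v := by
  intro as has hmem
  have hperm : as.Perm [b, c] := by
    refine (List.perm_ext_iff_of_nodup has (by simp [hbc])).2 fun a => ?_
    rw [hmem a]
    exact (hv a).trans (by simp)
  rcases List.perm_pair.1 hperm with rfl | rfl
  · exact h
  · exact h'

theorem permCond_six : protocol.PermCond 6 := by
  refine permCond_of_pair (b := 1) (c := 2) (by simp) (fun a => by fin_cases a <;> simp [role])
    ⟨[4, 5, 6], ⟨by simp, ?_, four_mem_Iset, rfl⟩, ?_⟩
    ⟨[2, 4, 6], ⟨by simp, ?_, two_mem_Iset, rfl⟩, ?_⟩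
  · change List.IsChain edge _
    simp [edge]
  · simp [role]
  · change List.IsChain edge _
    simp [edge]
  · simp [role]

theorem permCond_seven : protocol.PermCond 7 := by
  refine permCond_of_pair (b := 0) (c := 2) (by simp) (fun a => by fin_cases a <;> simp [role])
    ⟨[3, 5, 7], ⟨by simp, ?_, three_mem_Iset, rfl⟩, ?_⟩
    ⟨[2, 3, 5, 7], ⟨by simp, ?_, two_mem_Iset, rfl⟩, ?_⟩
  · change List.IsChain edge _
    simp [edge]
  · simp [role]
  · change List.IsChain edge _
    simp [edge]
  · simp [role]

theorem permCond_eight : protocol.PermCond 8 := by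
  refine permCond_of_pair (b := 0) (c := 1) (by simp) (fun a => by fin_cases a <;> simp [role])
    ⟨[3, 4, 5, 8], ⟨by simp, ?_, three_mem_Iset, rfl⟩, ?_⟩
    ⟨[4, 6, 8], ⟨by simp, ?_, four_mem_Iset, rfl⟩, ?_⟩
  · change List.IsChain edge _
    simp [edge]
  · simp [role]
  · change List.IsChain edge _
    simp [edge]
  · simp [role]

theorem Kpre_eleven : protocol.Kpre 11 = ∅ := by
  refine Set.eq_empty_of_forall_notMem fun e he => ?_
  have h := lt_of_mem_Kpre he
  have := role_eq_zero (h.2.2.2.1.trans rfl)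
  have := h.2.2.2.2 rfl
  omega

theorem hon_eleven (v : Fin 13) {U : Set (Fin 13)} (hU : U ⊆ {11}) : protocol.hon v U := by
  rintro ⟨e, he, -⟩
  obtain ⟨u, hu, hmem⟩ := Set.mem_iUnion₂.1 he
  obtain rfl : u = 11 := hU hu
  simp [Kpre_eleven] at hmem

theorem isAC_protocol : protocol.IsAC [11] 6 := by
  refine ⟨by simp, by simp, fun _ => ?_, by simp, fun i hi => ?_, fun i hi => ?_, fun _ => ?_⟩
  · exact mem_InitSet 1 (by simp [role]) (by simp [Kpre_eleven])
  · exact hon_eleven _ fun w hw => by simpa using List.mem_of_mem_take hw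
  · simp at hi
  · refine ⟨fun v hv _ => ?_, mem_Sig.2 (by simp), notMem_EndSet (by simp), rfl, ?_⟩
    · have := cprec_edge_iff.1 hv
      exact notMem_EndSet (by simp at this; omega)
    · rintro (h | h)
      · have := cprec_edge_iff.1 h
        simp at this
      · simp at h

end ForkedChain

/-- There is an optimistic DAG MPCS protocol over three signers which
satisfies the permutation condition at every vertex of the signing set, and yet has an
abort-chaining sequence (hence is not fair): the permutation condition necessary for
fairness is not sufficient. -/
theorem perm_condition_not_sufficient :
    ∃ (V : Type) (P : MPCS V (Fin 3)),
      P.Optimistic ∧ (∀ v ∈ P.Sig, P.PermCond v) ∧ ∃ vs s, P.IsAC vs s := by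
  refine ⟨Fin 13, ForkedChain.protocol, ForkedChain.optimistic_protocol, fun v hv => ?_,
    [11], 6, ForkedChain.isAC_protocol⟩
  rcases ForkedChain.mem_Sig.1 hv with rfl | rfl | rfl
  · exact ForkedChain.permCond_six
  · exact ForkedChain.permCond_seven
  · exact ForkedChain.permCond_eight
end

section
/- Let P be an optimistic DAG MPCS protocol over a set S of n signers with no abort-chaining sequence (equivalently, fair), and let v₁, …, v_k be any topological ordering of the vertices of V ∖ {v_T} (i.e., an enumeration of V ∖ {v_T} such that (v_i, v_j) ∈ E implies i < j). Then the role sequence (r(v₁), …, r(v_k)) contains every permutation of S as a (not necessarily consecutive) subsequence; in particular, the number of vertices of P other than v_T is at least λ(n), the length of a shortest sequence over an n-element set containing every permutation of the set as a subsequence. -/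
attribute [local instance] Classical.propDecidable

/-- `λ(n)`: the length of a shortest sequence over an `n`-element set containing every
permutation of the set as a (not necessarily consecutive) subsequence. -/
noncomputable def lambdaSeq (n : ℕ) : ℕ :=
  sInf {l | ∃ w : List (Fin n), w.length = l ∧
    ∀ p : List (Fin n), p.Nodup → p.length = n → p.Sublist w}

namespace MPCS

variable {V S : Type} {P : MPCS V S}

/-- `pos` is strictly increasing along the edges, hence along the causal order. -/
structure IsLinearization (P : MPCS V S) (pos : V → ℕ) : Prop where
  lt_of_edge : ∀ u w, P.E u w → pos u < pos w

/-- The first `m + 1` values of `v` match the first `m + 1` roles in `as` greedily: each `v i` is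
the first vertex with its role after its predecessor in the order given by `pos`. -/
structure IsGreedy (P : MPCS V S) (pos : V → ℕ) (as : List S) (v : ℕ → V) (m : ℕ) : Prop where
  role_eq : ∀ i ≤ m, P.role (v i) = as[i]?
  pos_lt : ∀ i < m, pos (v i) < pos (v (i + 1))
  pos_zero_le : ∀ u, P.role u = as[0]? → pos (v 0) ≤ pos u
  pos_succ_le : ∀ i < m, ∀ u, P.role u = as[i + 1]? → pos (v i) < pos u → pos (v (i + 1)) ≤ pos u

theorem IsLinearization.lt_of_cprec {pos : V → ℕ} (hpos : P.IsLinearization pos) {u w : V}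
    (h : cprec P.E u w) : pos u < pos w := by
  unfold cprec at h
  induction h with
  | single h => exact hpos.lt_of_edge _ _ h
  | tail _ h ih => exact ih.trans (hpos.lt_of_edge _ _ h)

theorem IsLinearization.le_of_cpreceq {pos : V → ℕ} (hpos : P.IsLinearization pos) {u w : V}
    (h : cpreceq P.E u w) : pos u ≤ pos w := by
  rcases h with h | rfl
  · exact (hpos.lt_of_cprec h).le
  · exact le_rfl

namespace IsGreedy

variable {pos : V → ℕ} {as : List S} {v : ℕ → V} {m : ℕ}

theorem mono (h : P.IsGreedy pos as v m) {k : ℕ} (hk : k ≤ m) : P.IsGreedy pos as v k where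
  role_eq i hi := h.role_eq i (hi.trans hk)
  pos_lt i hi := h.pos_lt i (hi.trans_le hk)
  pos_zero_le := h.pos_zero_le
  pos_succ_le i hi := h.pos_succ_le i (hi.trans_le hk)

theorem pos_lt_pos (h : P.IsGreedy pos as v m) {i j : ℕ} (hij : i < j) (hj : j ≤ m) :
    pos (v i) < pos (v j) := by
  induction j, hij using Nat.le_induction with
  | base => exact h.pos_lt i hj
  | succ j _ ih => exact (ih (by omega)).trans (h.pos_lt j hj)

theorem pos_le_pos (h : P.IsGreedy pos as v m) {i j : ℕ} (hij : i ≤ j) (hj : j ≤ m) :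
    pos (v i) ≤ pos (v j) := by
  rcases hij.eq_or_lt with rfl | hij
  · exact le_rfl
  · exact (h.pos_lt_pos hij hj).le

theorem zero_mem_initSet (h : P.IsGreedy pos as v m) (hpos : P.IsLinearization pos) :
    v 0 ∈ P.InitSet := by
  intro huniv
  have hrole : ∀ b : S, P.role (v 0) = some b := by
    intro b
    have hb := huniv.symm ▸ Set.mem_univ b
    rcases hb with ⟨e, ⟨-, he, hr⟩, -⟩ | hb
    · exact absurd (h.pos_zero_le e.2 (hr.trans (h.role_eq 0 (Nat.zero_le _))))
        (hpos.lt_of_cprec he).not_ge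
    · exact hb
  have : Subsingleton S := ⟨fun b c => Option.some.inj ((hrole b).symm.trans (hrole c))⟩
  have := P.two_le_card
  have := Finite.card_le_one_iff_subsingleton (α := S) |>.2 ‹_›
  omega

theorem hon_of_le (h : P.IsGreedy pos as v m) (hpos : P.IsLinearization pos) {i : ℕ} (hi : i ≤ m)
    {U : Set V} (hU : ∀ w ∈ U, ∃ j ≤ i, w = v j) : P.hon (v i) U := by
  rintro ⟨e, he, hle, -⟩
  obtain ⟨w, hw, hmsg, hprec, -⟩ := Set.mem_iUnion₂.1 he
  obtain ⟨j, hj, rfl⟩ := hU w hw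
  have h1 := hpos.le_of_cpreceq hle
  have h2 := hpos.lt_of_edge _ _ hmsg.1
  have h3 := hpos.lt_of_cprec hprec
  have h4 := h.pos_le_pos hj hi
  omega

theorem hon_of_le_succ (h : P.IsGreedy pos as v m) (hpos : P.IsLinearization pos) {i : ℕ}
    (hi : i < m) {U : Set V} (hU : ∀ w ∈ U, ∃ j ≤ i + 1, w = v j) : P.hon (v i) U := by
  rintro ⟨e, he, hle, -⟩
  obtain ⟨w, hw, hmsg, hprec, hr⟩ := Set.mem_iUnion₂.1 he
  obtain ⟨j, hj, rfl⟩ := hU w hw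
  have h1 := hpos.le_of_cpreceq hle
  have h2 := hpos.lt_of_edge _ _ hmsg.1
  have h3 := hpos.lt_of_cprec hprec
  rcases hj.eq_or_lt with rfl | hj
  · have h4 := h.pos_succ_le i hi e.2 (hr.trans (h.role_eq _ hi)) (by omega)
    omega
  · have h4 := h.pos_le_pos (Nat.le_of_lt_succ hj) hi.le
    omega

theorem isAC (h : P.IsGreedy pos as v m) (hpos : P.IsLinearization pos) (has : as.Nodup)
    (hm : m < as.length) {s : V}
    (hend : ∀ w, cprec P.E w (v m) → P.role w = P.role (v m) → w ∉ P.EndSet)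
    (hsig : s ∈ P.Sig) (hs : s ∉ P.EndSet) (hrole : P.role s = P.role (v m))
    (hvs : ¬ cpreceq P.E (v m) s) :
    P.IsAC ((List.range (m + 1)).map v) s := by
  have htake : ∀ k, ∀ w ∈ {w | w ∈ ((List.range (m + 1)).map v).take (k + 1)},
      ∃ j ≤ k, w = v j := by
    intro k w hw
    rw [Set.mem_ofPred_eq, ← List.map_take, List.take_range, List.mem_map] at hw
    obtain ⟨j, hj, rfl⟩ := hw
    rw [List.mem_range] at hj
    exact ⟨j, by omega, rfl⟩
  refine ⟨by simp, ?_, ?_, ?_, ?_, ?_, ?_⟩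
  · have := P.sfin
    have := Fintype.ofFinite S
    have := has.length_le_card
    rw [List.length_map, List.length_range, Nat.card_eq_fintype_card]
    omega
  · intro _
    simpa using h.zero_mem_initSet hpos
  · rw [List.pairwise_map]
    refine List.Pairwise.imp_of_mem ?_ (List.pairwise_lt_range (n := m + 1))
    intro i j hi hj hij heq
    rw [List.mem_range] at hi hj
    rw [h.role_eq i (by omega), h.role_eq j (by omega)] at heq
    exact hij.ne ((List.getElem?_inj (by omega) has).1 heq)
  · intro i hi
    have hi' : i ≤ m := by simpa [Nat.lt_succ_iff] using hi
    simpa using h.hon_of_le hpos hi' (htake i)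
  · intro i hi
    have hi' : i < m := by simpa using hi
    simpa using h.hon_of_le_succ hpos hi' (htake (i + 1))
  · intro _
    simpa [List.getLast_range] using ⟨hend, hsig, hs, hrole, hvs⟩

/-- An end vertex with a role other than that of `v m` and positioned before `v m` yields, by
fairness, an end vertex with the role of `v m` positioned before `v m`. -/
theorem exists_mem_endSet (h : P.IsGreedy pos as v m) (hpos : P.IsLinearization pos)
    (hfair : P.NoAC) (has : as.Nodup) (hm : m < as.length) {e : V} (he : e ∈ P.EndSet)
    (hrole : P.role e ≠ as[m]?) (hle : pos e ≤ pos (v m)) :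
    ∃ x ∈ P.EndSet, P.role x = as[m]? ∧ pos x < pos (v m) := by
  have hb : as[m] ∈ {a : S | (∃ d ∈ P.K e, d.1 ∈ P.Sig ∧ P.role d.1 = some a) ∨
      P.role e = some a} := he.symm ▸ Set.mem_univ _
  rw [Set.mem_ofPred_eq, ← List.getElem?_eq_getElem hm] at hb
  obtain ⟨d, ⟨hmsg, hde, -⟩, hsig, hd⟩ := hb.resolve_right hrole
  have hlt : pos d.1 < pos (v m) :=
    (hpos.lt_of_edge _ _ hmsg.1).trans_le ((hpos.le_of_cpreceq hde).trans hle)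
  have hvm := h.role_eq m le_rfl
  by_contra! hno
  refine hfair ⟨_, d.1, h.isAC hpos has hm ?_ hsig ?_ (hd.trans hvm.symm) ?_⟩
  · intro w hw hr hend
    exact (hno w hend (hr.trans hvm)).not_gt (hpos.lt_of_cprec hw)
  · intro hend
    exact (hno _ hend hd).not_gt hlt
  · intro hprec
    exact (hpos.le_of_cpreceq hprec).not_gt hlt

theorem pos_lt_of_mem_endSet (h : P.IsGreedy pos as v m) (hpos : P.IsLinearization pos)
    (hfair : P.NoAC) (has : as.Nodup) (hm : m < as.length) {e : V} (he : e ∈ P.EndSet)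
    (hrole : P.role e ≠ as[m]?) : pos (v m) < pos e := by
  induction m generalizing e with
  | zero =>
    by_contra! hle
    obtain ⟨x, -, hx, hlt⟩ := h.exists_mem_endSet hpos hfair has hm he hrole hle
    exact (h.pos_zero_le x hx).not_gt hlt
  | succ m ih =>
    by_contra! hle
    obtain ⟨x, hend, hx, hlt⟩ := h.exists_mem_endSet hpos hfair has hm he hrole hle
    refine (h.pos_succ_le m m.lt_succ_self x hx ?_).not_gt hlt
    refine ih (h.mono m.le_succ) (by omega) hend fun heq => ?_
    have := (List.getElem?_inj hm has).1 (hx.symm.trans heq)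
    omega

end IsGreedy

theorem exists_isGreedy {pos : V → ℕ} (hpos : P.IsLinearization pos) (hopt : P.Optimistic)
    (hfair : P.NoAC) {as : List S} (has : as.Nodup) (hne : as ≠ []) :
    ∃ v : ℕ → V, ∀ m < as.length, P.IsGreedy pos as v m := by
  have hmin : ∀ Q : V → Prop, (∃ u, Q u) → ∃ u, Q u ∧ ∀ w, Q w → pos u ≤ pos w := by
    intro Q hQ
    obtain ⟨u, hu, hle⟩ := exists_minimalFor_of_wellFoundedLT Q pos hQ
    exact ⟨u, hu, fun w hw => (le_total (pos u) (pos w)).elim id (hle hw)⟩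
  have hzero : 0 < as.length := List.length_pos_of_ne_nil hne
  obtain ⟨v₀, hv₀, hmin₀⟩ := hmin (fun u => P.role u = as[0]?) <| by
    obtain ⟨u, -, hu⟩ := (hopt as[0]).1
    exact ⟨u, hu.trans (List.getElem?_eq_getElem hzero).symm⟩
  have hnext : ∀ (x : V) (o : Option S), ∃ y, (∃ u, P.role u = o ∧ pos x < pos u) →
      (P.role y = o ∧ pos x < pos y) ∧ ∀ w, P.role w = o ∧ pos x < pos w → pos y ≤ pos w := by
    intro x o
    by_cases hex : ∃ u, P.role u = o ∧ pos x < pos u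
    · obtain ⟨y, hy⟩ := hmin _ hex
      exact ⟨y, fun _ => hy⟩
    · exact ⟨x, fun h => absurd h hex⟩
  choose next hnext using hnext
  let v : ℕ → V := fun i => Nat.rec v₀ (fun i x => next x as[i + 1]?) i
  refine ⟨v, fun m => ?_⟩
  induction m with
  | zero =>
    intro _
    exact ⟨fun i hi => by rwa [Nat.le_zero.1 hi], fun i hi => absurd hi i.not_lt_zero, hmin₀,
      fun i hi => absurd hi i.not_lt_zero⟩
  | succ m ih =>
    intro hm
    have hg := ih (by omega)
    obtain ⟨e, he, hrole⟩ := (hopt as[m + 1]).2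
    rw [← List.getElem?_eq_getElem hm] at hrole
    have hlt := hg.pos_lt_of_mem_endSet hpos hfair has (by omega) he fun heq => by
      have := (List.getElem?_inj hm has).1 (hrole.symm.trans heq)
      omega
    obtain ⟨hy, hle⟩ := hnext (v m) as[m + 1]? ⟨e, hrole, hlt⟩
    refine ⟨fun i hi => ?_, fun i hi => ?_, hmin₀, fun i hi => ?_⟩
    · rcases hi.eq_or_lt with rfl | hi
      · exact hy.1
      · exact hg.role_eq i (Nat.le_of_lt_succ hi)
    · rcases (Nat.le_of_lt_succ hi).eq_or_lt with rfl | hi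
      · exact hy.2
      · exact hg.pos_lt i hi
    · rcases (Nat.le_of_lt_succ hi).eq_or_lt with rfl | hi
      · exact fun u hu hlt => hle u ⟨hu, hlt⟩
      · exact hg.pos_succ_le i hi

/-- A topological ordering of the vertices other than `vT` linearizes the causal order. -/
theorem isLinearization_idxOf (P : MPCS V S) {vs : List V}
    (hmem : ∀ v : V, v ∈ vs ↔ v ≠ P.vT)
    (htopo : ∀ i j : Fin vs.length, P.E (vs.get i) (vs.get j) → (i : ℕ) < (j : ℕ)) :
    P.IsLinearization fun v => vs.idxOf v where
  lt_of_edge u w h := by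
    have hu : u ∈ vs := by
      rw [hmem]
      rintro rfl
      by_cases hw : w = P.vT
      · exact P.acyclic _ (.single (hw ▸ h))
      · exact P.acyclic _ (.tail (.single h) (P.exit_edges w hw))
    have hu' := List.idxOf_lt_length_iff.2 hu
    by_cases hw : w ∈ vs
    · exact htopo ⟨_, hu'⟩ ⟨_, List.idxOf_lt_length_iff.2 hw⟩ (by simpa using h)
    · exact hu'.trans_eq (List.idxOf_eq_length hw).symm

theorem map_some_sublist_map_role (hopt : P.Optimistic) (hfair : P.NoAC) {vs : List V}
    (hmem : ∀ v : V, v ∈ vs ↔ v ≠ P.vT)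
    (htopo : ∀ i j : Fin vs.length, P.E (vs.get i) (vs.get j) → (i : ℕ) < (j : ℕ))
    {as : List S} (has : as.Nodup) : (as.map some).Sublist (vs.map P.role) := by
  rcases eq_or_ne as [] with rfl | hne
  · simp
  obtain ⟨v, hv⟩ := exists_isGreedy (P.isLinearization_idxOf hmem htopo) hopt hfair has hne
  have hrole : ∀ i (hi : i < as.length), P.role (v i) = some as[i] := fun i hi =>
    ((hv i hi).role_eq i le_rfl).trans (List.getElem?_eq_getElem hi)
  have hvs : ∀ i < as.length, vs.idxOf (v i) < vs.length := by
    intro i hi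
    rw [List.idxOf_lt_length_iff, hmem]
    intro h
    simpa [h, P.vT_role] using hrole i hi
  rw [List.sublist_iff_exists_fin_orderEmbedding_get_eq]
  refine ⟨OrderEmbedding.ofStrictMono
    (fun i => ⟨vs.idxOf (v i), by simpa using hvs i (by simpa using i.2)⟩) ?_, fun i => ?_⟩
  · intro i j hij
    have hj : (j : ℕ) < as.length := by simpa using j.2
    exact (hv j hj).pos_lt_pos hij le_rfl
  · have hi : (i : ℕ) < as.length := by simpa using i.2
    rw [List.get_eq_getElem, List.get_eq_getElem, List.getElem_map, List.getElem_map]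
    exact ((congrArg P.role (List.getElem_idxOf (hvs i hi))).trans (hrole i hi)).symm

end MPCS

/-- A sequence over a nonempty finite type containing all permutations has length at least
`lambdaSeq`. -/
theorem lambdaSeq_le_length {α : Type*} [Finite α] [Nonempty α] {l : List (Option α)}
    (hl : ∀ as : List α, as.Nodup → (as.map some).Sublist l) :
    lambdaSeq (Nat.card α) ≤ l.length := by
  obtain ⟨a₀⟩ := ‹Nonempty α›
  let e := Finite.equivFin α
  refine Nat.sInf_le ⟨l.map fun o => e (o.getD a₀), List.length_map _, fun p hp _ => ?_⟩
  have := (hl (p.map e.symm) (hp.map e.symm.injective)).map fun o => e (o.getD a₀)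
  simpa [Function.comp_def] using this

/-- In an optimistic fair (no abort-chaining sequence) DAG MPCS protocol,
the role sequence of any topological ordering of the non-TTP vertices contains every
permutation of the set of signers as a subsequence; in particular there are at least
`λ(n)` vertices other than the TTP vertex. -/
theorem topological_order_contains_all_permutations {V S : Type} (P : MPCS V S)
    (hopt : P.Optimistic) (hfair : P.NoAC)
    (vs : List V) (hnd : vs.Nodup)
    (hmem : ∀ v : V, v ∈ vs ↔ v ≠ P.vT)
    (htopo : ∀ i j : Fin vs.length, P.E (vs.get i) (vs.get j) → (i : ℕ) < (j : ℕ)) :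
    (∀ as : List S, as.Nodup → (∀ b : S, b ∈ as) →
      (as.map some).Sublist (vs.map P.role)) ∧
    lambdaSeq (Nat.card S) ≤ vs.length := by
  have hsub := fun (as : List S) (has : as.Nodup) =>
    MPCS.map_some_sublist_map_role hopt hfair hmem htopo has
  refine ⟨fun as has _ => hsub as has, ?_⟩
  have := P.sfin
  have : Nonempty S := Finite.card_pos_iff.1 (by have := P.two_le_card; omega)
  simpa using lambdaSeq_le_length hsub
end
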